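/- arXiv:1504.04879 — 4 statements merged into one kernel-verified Lean document; each statement's English description precedes it below -/
import Mathlib

section
/- In R = MvPolynomial (Fin 9) ℤ, the second elementary symmetric function of the multiset W((2,1,1,1,1), 9) of weights of semistandard Young tableaux of shape (2,1,1,1,1) with entries in {0,…,8} is congruent to 420·e₂ modulo the ideal generated by e₁; equivalently, c₂(γ₉^{(2,1,1,1,1)}) = 420·c₂(γ₉), the Table 2 entry for the weight α₁+α₅ of SL₉/μ₃. -/
open MvPolynomial

open scoped Classical in
/-- The multiset `W(lam, n)` of weights of semistandard Young tableaux of shape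
`lam` (a list of row lengths) with entries in `{0, …, n-1}`: a tableau assigns
to each cell `(i, j)` of the Young diagram of `lam` an entry in `Fin n`, weakly
increasing along rows and strictly increasing down columns; its weight is the
sum `∑_{(i,j) ∈ lam} X_{T(i,j)}`. -/
noncomputable def ssytWeights (lam : List ℕ) (n : ℕ) :
    Multiset (MvPolynomial (Fin n) ℤ) :=
  ((Finset.univ : Finset ((i : Fin lam.length) → Fin (lam.get i) → Fin n)).filter
      (fun T =>
        (∀ (i : Fin lam.length) (j j' : Fin (lam.get i)), (j : ℕ) ≤ (j' : ℕ) → T i j ≤ T i j') ∧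
        (∀ (i i' : Fin lam.length), (i : ℕ) < (i' : ℕ) →
          ∀ (j : Fin (lam.get i')) (hj : (j : ℕ) < lam.get i), T i ⟨j, hj⟩ < T i' j))).val.map
    (fun T => ∑ i, ∑ j, MvPolynomial.X (T i j))

/-- Twice the second elementary symmetric function is `p₁² - p₂`. -/
theorem Multiset.two_mul_esymm_two {R : Type*} [CommRing R] (s : Multiset R) :
    2 * s.esymm 2 = s.sum ^ 2 - (s.map (· ^ 2)).sum := by
  induction s using Multiset.induction_on with
  | empty => simp [Multiset.esymm, Multiset.powersetCard_zero_right]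
  | cons a s ih =>
    have h : (a ::ₘ s).esymm 2 = s.esymm 2 + a * s.sum := by
      simp [Multiset.esymm, Multiset.powersetCard_cons, Multiset.powersetCard_one,
        Multiset.map_map]
      simpa using Multiset.sum_map_mul_left (s := s) (a := a) (f := id)
    rw [h, mul_add, ih, Multiset.sum_cons, Multiset.map_cons, Multiset.sum_cons]
    ring

section SubsetSums

variable {ι R : Type*} [Fintype ι] [DecidableEq ι] [CommRing R]

theorem sum_powersetCard_sum (k : ℕ) (x : ι → R) :
    ∑ s ∈ Finset.powersetCard (k + 1) Finset.univ, ∑ i ∈ s, x i =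
      ((Fintype.card ι - 1).choose k : R) * ∑ i, x i := by
  have hcount (i : ι) :
      ((Finset.powersetCard (k + 1) (Finset.univ : Finset ι)).filter (i ∈ ·)).card =
        (Fintype.card ι - 1).choose k := by
    simpa using Finset.card_filter_powersetCard_subset {i} (Finset.univ : Finset ι) (k + 1)
      (Finset.subset_univ _) (by simp)
  have hsum (s : Finset ι) : ∑ i ∈ s, x i = ∑ i, if i ∈ s then x i else 0 := by simp
  rw [Finset.sum_congr rfl fun s _ => hsum s, Finset.sum_comm, Finset.mul_sum]
  refine Finset.sum_congr rfl fun i _ => ?_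
  rw [← Finset.sum_filter, Finset.sum_const, hcount, nsmul_eq_mul]

theorem sum_powersetCard_sum_sq (k : ℕ) (x : ι → R) :
    ∑ s ∈ Finset.powersetCard (k + 2) Finset.univ, (∑ i ∈ s, x i) ^ 2 =
      ((Fintype.card ι - 2).choose k : R) * (∑ i, x i) ^ 2 +
        (((Fintype.card ι - 1).choose (k + 1) : R) - (Fintype.card ι - 2).choose k) *
          ∑ i, x i ^ 2 := by
  have hcount (i j : ι) :
      (((Finset.powersetCard (k + 2) (Finset.univ : Finset ι)).filter
        (fun s => i ∈ s ∧ j ∈ s)).card : R) =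
        (Fintype.card ι - 2).choose k +
          if i = j then ((Fintype.card ι - 1).choose (k + 1) : R) - (Fintype.card ι - 2).choose k
          else 0 := by
    have h := Finset.card_filter_powersetCard_subset {i, j} (Finset.univ : Finset ι) (k + 2)
      (Finset.subset_univ _) (Finset.card_le_two.trans (by simp))
    simp only [Finset.insert_subset_iff, Finset.singleton_subset_iff, Finset.card_univ] at h
    rw [h]
    by_cases hij : i = j
    · simp [hij]
    · simp [hij, Finset.card_pair hij]
  have hsum (s : Finset ι) :
      (∑ i ∈ s, x i) ^ 2 = ∑ i, ∑ j, if i ∈ s ∧ j ∈ s then x i * x j else 0 := by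
    have h : ∑ i ∈ s, x i = ∑ i, if i ∈ s then x i else 0 := by simp
    rw [sq, h, Finset.sum_mul_sum]
    refine Finset.sum_congr rfl fun i _ => Finset.sum_congr rfl fun j _ => ?_
    by_cases hi : i ∈ s <;> by_cases hj : j ∈ s <;> simp [hi, hj]
  rw [Finset.sum_congr rfl fun s _ => hsum s, Finset.sum_comm]
  simp_rw [Finset.sum_comm (s := Finset.powersetCard (k + 2) Finset.univ), ← Finset.sum_filter,
    Finset.sum_const, nsmul_eq_mul, hcount, add_mul, Finset.sum_add_distrib, ite_mul, zero_mul,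
    Finset.sum_ite_eq, Finset.mem_univ, if_true]
  rw [sq (∑ i, x i), Finset.sum_mul_sum, Finset.mul_sum, Finset.mul_sum]
  congr 1
  · simp_rw [Finset.mul_sum]
  · simp_rw [sq]

end SubsetSums

/-- Pairs of a `k`-subset `s` and an element `b` below all of `s` are `(k + 1)`-subsets. -/
theorem sum_filter_forall_lt_powersetCard {ι R A : Type*} [Fintype ι] [LinearOrder ι]
    [AddCommMonoid R] [AddCommMonoid A] (k : ℕ) (x : ι → R) (f : R → A) :
    ∑ p ∈ (Finset.powersetCard k (Finset.univ : Finset ι) ×ˢ Finset.univ).filter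
        (fun p => ∀ a ∈ p.1, p.2 < a), f (x p.2 + ∑ i ∈ p.1, x i) =
      ∑ u ∈ Finset.powersetCard (k + 1) Finset.univ, f (∑ i ∈ u, x i) := by
  refine Finset.sum_bij (fun p _ => insert p.2 p.1) ?_ ?_ ?_ ?_
  · rintro ⟨s, b⟩ hp
    simp only [Finset.mem_filter, Finset.mem_product, Finset.mem_powersetCard_univ,
      Finset.mem_univ, and_true] at hp ⊢
    rw [Finset.card_insert_of_notMem fun h => lt_irrefl _ (hp.2 _ h), hp.1]
  · rintro ⟨s, b⟩ hp ⟨t, c⟩ hq h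
    simp only [Finset.mem_filter, Finset.mem_product, Finset.mem_powersetCard_univ,
      Finset.mem_univ, and_true] at hp hq h
    have hb : b ∉ s := fun h => lt_irrefl _ (hp.2 _ h)
    have hc : c ∉ t := fun h => lt_irrefl _ (hq.2 _ h)
    have hbc : b = c := by
      have h1 : b ∈ insert c t := h ▸ Finset.mem_insert_self b s
      have h2 : c ∈ insert b s := h ▸ Finset.mem_insert_self c t
      rcases Finset.mem_insert.1 h1 with h1 | h1
      · exact h1
      · rcases Finset.mem_insert.1 h2 with h2 | h2
        · exact h2.symm
        · exact absurd (hp.2 _ h2) (hq.2 _ h1).asymm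
    subst hbc
    rw [← Finset.erase_insert hb, h, Finset.erase_insert hc]
  · intro u hu
    rw [Finset.mem_powersetCard_univ] at hu
    have hne : u.Nonempty := Finset.card_pos.1 (by omega)
    refine ⟨(u.erase (u.min' hne), u.min' hne), ?_, Finset.insert_erase (u.min'_mem hne)⟩
    simp only [Finset.mem_filter, Finset.mem_product, Finset.mem_powersetCard_univ,
      Finset.mem_univ, and_true]
    refine ⟨by rw [Finset.card_erase_of_mem (u.min'_mem hne), hu]; rfl, fun a ha => ?_⟩
    exact u.min'_lt_of_mem_erase_min' hne ha
  · rintro ⟨s, b⟩ hp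
    simp only [Finset.mem_filter] at hp
    rw [Finset.sum_insert fun h => lt_irrefl _ (hp.2 _ h)]

/-- A tableau of shape `(2, 1, 1, 1, 1)` is a 5-subset `s` (the first column) together with an
entry `b` which is at least the minimum of `s`. -/
theorem sum_map_ssytWeights {A : Type*} [AddCommMonoid A] (n : ℕ)
    (f : MvPolynomial (Fin n) ℤ → A) :
    ((ssytWeights [2, 1, 1, 1, 1] n).map f).sum =
      ∑ p ∈ (Finset.powersetCard 5 (Finset.univ : Finset (Fin n)) ×ˢ Finset.univ).filter
        (fun p => ¬ ∀ a ∈ p.1, p.2 < a), f (X p.2 + ∑ i ∈ p.1, X i) := by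
  classical
  have hpos : ∀ i : Fin 5, 0 < [2, 1, 1, 1, 1].get i := by decide
  have hcell : ∀ (i : Fin 5) (j : Fin ([2, 1, 1, 1, 1].get i)),
      j = ⟨0, hpos i⟩ ∨ (i = 0 ∧ (j : ℕ) = 1) := by
    simp only [Fin.ext_iff]
    decide
  have hmono {T : (i : Fin 5) → Fin ([2, 1, 1, 1, 1].get i) → Fin n}
      (hT : ∀ i i' : Fin 5, (i : ℕ) < (i' : ℕ) → ∀ (j : Fin ([2, 1, 1, 1, 1].get i'))
        (hj : (j : ℕ) < [2, 1, 1, 1, 1].get i), T i ⟨j, hj⟩ < T i' j) :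
      StrictMono fun i => T i ⟨0, hpos i⟩ := fun i i' h => hT i i' h ⟨0, hpos i'⟩ (hpos i)
  rw [ssytWeights, Multiset.map_map]
  refine Finset.sum_bij
    (fun T _ => (Finset.univ.image fun i : Fin 5 => T i ⟨0, hpos i⟩, T 0 ⟨1, by decide⟩)) ?_ ?_ ?_ ?_
  · intro T hT
    obtain ⟨hrow, hcol⟩ := (Finset.mem_filter.1 hT).2
    simp only [Finset.mem_filter, Finset.mem_product, Finset.mem_powersetCard_univ,
      Finset.mem_univ, and_true]
    refine ⟨?_, fun h => ?_⟩
    · rw [Finset.card_image_of_injective _ (hmono hcol).injective, Finset.card_univ,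
        Fintype.card_fin]
    · exact (hrow (0 : Fin 5) ⟨0, hpos 0⟩ ⟨1, by decide⟩ (Nat.zero_le _)).not_gt
        (h _ (Finset.mem_image_of_mem _ (Finset.mem_univ (0 : Fin 5))))
  · intro T hT T' hT' h
    obtain ⟨-, hcol⟩ := (Finset.mem_filter.1 hT).2
    obtain ⟨-, hcol'⟩ := (Finset.mem_filter.1 hT').2
    obtain ⟨h1, h2⟩ := Prod.ext_iff.1 h
    have h3 := ((hmono hcol).range_inj (hmono hcol')).1 (by
      simpa using congrArg (fun s : Finset (Fin n) => (s : Set (Fin n))) h1)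
    funext i j
    rcases hcell i j with rfl | ⟨rfl, hj⟩
    · exact congrFun h3 i
    · have : j = ⟨1, by decide⟩ := Fin.ext hj
      subst this
      exact h2
  · rintro ⟨s, b⟩ hp
    simp only [Finset.mem_filter, Finset.mem_product, Finset.mem_powersetCard_univ,
      Finset.mem_univ, and_true] at hp
    obtain ⟨hs, hb⟩ := hp
    push Not at hb
    obtain ⟨a, ha, hab⟩ := hb
    have hmin : s.orderEmbOfFin hs 0 ≤ b := by
      exact (Finset.orderEmbOfFin_zero hs (by norm_num)).trans_le ((s.min'_le a ha).trans hab)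
    refine ⟨fun i j => if (j : ℕ) = 0 then s.orderEmbOfFin hs i else b, ?_, ?_⟩
    · refine Finset.mem_filter.2 ⟨Finset.mem_univ _, fun i j j' hj => ?_, fun i i' hi j hj => ?_⟩
      · rcases hcell i j with rfl | ⟨rfl, h⟩
        · rcases hcell i j' with rfl | ⟨rfl, h'⟩
          · exact le_rfl
          · simpa [h'] using hmin
        · have h' : (j' : ℕ) ≠ 0 := by omega
          simp [h, h']
      · rcases hcell i' j with rfl | ⟨rfl, h⟩
        · simpa using hi
        · exact absurd hi (Nat.not_lt_zero _)
    · refine Prod.ext ?_ ?_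
      · simp
      · simp
  · intro T hT
    obtain ⟨-, hcol⟩ := (Finset.mem_filter.1 hT).2
    rw [Finset.sum_image (hmono hcol).injective.injOn]
    refine congrArg f ?_
    change ∑ i : Fin 5, ∑ j : Fin ([2, 1, 1, 1, 1].get i), _ = _
    rw [Fin.sum_univ_five, Fin.sum_univ_five]
    simp only [List.get]
    rw [Fin.sum_univ_two]
    simp only [Fin.sum_univ_one]
    change X (T 0 ⟨0, hpos 0⟩) + X (T 0 ⟨1, by decide⟩) + X (T 1 ⟨0, hpos 1⟩) + X (T 2 ⟨0, hpos 2⟩) +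
      X (T 3 ⟨0, hpos 3⟩) + X (T 4 ⟨0, hpos 4⟩) = _
    ring

theorem sum_map_ssytWeights_add {A : Type*} [AddCommMonoid A] (n : ℕ)
    (f : MvPolynomial (Fin n) ℤ → A) :
    ((ssytWeights [2, 1, 1, 1, 1] n).map f).sum +
        ∑ u ∈ Finset.powersetCard 6 Finset.univ, f (∑ i ∈ u, X i) =
      ∑ s ∈ Finset.powersetCard 5 Finset.univ, ∑ b, f (X b + ∑ i ∈ s, X i) := by
  rw [sum_map_ssytWeights, ← sum_filter_forall_lt_powersetCard, add_comm,
    Finset.sum_filter_add_sum_filter_not, Finset.sum_product]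

/-- `c₂(γ9^[2, 1, 1, 1, 1]) = 420·c₂(γ9)`: the second elementary symmetric function of
the multiset of weights of semistandard Young tableaux of shape `[2, 1, 1, 1, 1]` with
entries in `{0, …, 8}` is congruent to `420·e₂` modulo the ideal generated
by `e₁`. -/
theorem c2_ssyt_stmt16 :
    Multiset.esymm (ssytWeights [2, 1, 1, 1, 1] 9) 2 - 420 * esymm (Fin 9) ℤ 2
      ∈ Ideal.span {esymm (Fin 9) ℤ 1} := by
  set W := ssytWeights [2, 1, 1, 1, 1] 9
  set p : MvPolynomial (Fin 9) ℤ := ∑ i, X i with hp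
  set q : MvPolynomial (Fin 9) ℤ := ∑ i, X i ^ 2 with hq
  have hW : W.sum = 700 * p := by
    have h := sum_map_ssytWeights_add 9 id
    simp only [Multiset.map_id', id, Finset.sum_add_distrib, Finset.sum_const,
      Finset.card_powersetCard, Finset.card_univ, Fintype.card_fin, ← Finset.mul_sum,
      sum_powersetCard_sum 5, sum_powersetCard_sum 4, ← hp, nsmul_eq_mul] at h
    norm_num [Nat.choose] at h
    linear_combination h
  have hW2 : (W.map (· ^ 2)).sum = 420 * p ^ 2 + 420 * q := by
    have h := sum_map_ssytWeights_add 9 (· ^ 2)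
    simp only [add_sq, Finset.sum_add_distrib, Finset.sum_const, ← Finset.sum_mul,
      ← Finset.mul_sum,
      Finset.card_powersetCard, Finset.card_univ, Fintype.card_fin,
      sum_powersetCard_sum_sq 4, sum_powersetCard_sum_sq 3, sum_powersetCard_sum 4,
      ← hp, ← hq, nsmul_eq_mul] at h
    norm_num [Nat.choose] at h
    linear_combination h
  have he : 2 * esymm (Fin 9) ℤ 2 = p ^ 2 - q := by
    rw [esymm_eq_multiset_esymm, Multiset.two_mul_esymm_two, Multiset.map_map]
    rfl
  have h2 := Multiset.two_mul_esymm_two W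
  rw [hW, hW2] at h2
  rw [Ideal.mem_span_singleton, esymm_one]
  refine ⟨244580 * p, mul_left_cancel₀ (two_ne_zero (α := MvPolynomial (Fin 9) ℤ)) ?_⟩
  linear_combination h2 - 420 * he
end

section
/- In R = MvPolynomial (Fin 9) ℤ, the second elementary symmetric function of the multiset W((2,2,2,2,1), 9) of weights of semistandard Young tableaux of shape (2,2,2,2,1) with entries in {0,…,8} is congruent to 5292·e₂ modulo the ideal generated by e₁; equivalently, c₂(γ₉^{(2,2,2,2,1)}) = 5292·c₂(γ₉), the Table 2 entry for the weight α₄+α₅ of SL₉/μ₃. -/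
open MvPolynomial

theorem Fintype.sum_cons_get {M : Type*} [AddCommMonoid M] {n r : ℕ} {lam : List ℕ}
    (f : ((i : Fin (r :: lam).length) → Fin ((r :: lam).get i) → Fin n) → M) :
    ∑ T, f T = ∑ row : Fin r → Fin n, ∑ T : (i : Fin lam.length) → Fin (lam.get i) → Fin n,
      f (Fin.cons (α := fun i : Fin (lam.length + 1) => Fin ((r :: lam).get i) → Fin n) row T) := by
  rw [← Fintype.sum_prod_type']
  exact ((Fin.consEquiv fun i : Fin (lam.length + 1) =>
    Fin ((r :: lam).get i) → Fin n).sum_comp f).symm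

theorem Fintype.sum_fin_two_arrow {M α : Type*} [AddCommMonoid M] [Fintype α]
    (f : (Fin 2 → α) → M) : ∑ r, f r = ∑ a, ∑ b, f ![a, b] := by
  rw [← Fintype.sum_prod_type', ← (finTwoArrowEquiv α).symm.sum_comp]
  rfl

theorem Fintype.sum_fin_one_arrow {M α : Type*} [AddCommMonoid M] [Fintype α]
    (f : (Fin 1 → α) → M) : ∑ r, f r = ∑ a, f ![a] := by
  rw [← (Equiv.funUnique (Fin 1) α).symm.sum_comp]
  refine Fintype.sum_congr _ _ fun a => congrArg f ?_
  ext i; fin_cases i; rfl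

/-- Fillings of the Young diagram with row lengths `lam` by entries in `Fin n`. -/
abbrev Filling (lam : List ℕ) (n : ℕ) := (i : Fin lam.length) → Fin (lam.get i) → Fin n

/-- Rows are weakly increasing and columns are strictly increasing. -/
def Filling.IsSemistandard {lam : List ℕ} {n : ℕ} (T : Filling lam n) : Prop :=
  (∀ (i : Fin lam.length) (j j' : Fin (lam.get i)), (j : ℕ) ≤ (j' : ℕ) → T i j ≤ T i j') ∧
    (∀ (i i' : Fin lam.length), (i : ℕ) < (i' : ℕ) →
      ∀ (j : Fin (lam.get i')) (hj : (j : ℕ) < lam.get i), T i ⟨j, hj⟩ < T i' j)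

/-- The filling of shape `(2, 2, 2, 2, 1)` with first column `a` and second column `b`. -/
def Filling.ofEntries {n : ℕ} (a₀ b₀ a₁ b₁ a₂ b₂ a₃ b₃ a₄ : Fin n) : Filling [2, 2, 2, 2, 1] n :=
  fun i => match i with
  | 0 => ![a₀, b₀]
  | 1 => ![a₁, b₁]
  | 2 => ![a₂, b₂]
  | 3 => ![a₃, b₃]
  | 4 => ![a₄]

theorem Filling.sum_eq {M : Type*} [AddCommMonoid M] {n : ℕ} (f : Filling [2, 2, 2, 2, 1] n → M) :
    ∑ T, f T = ∑ a₀, ∑ b₀, ∑ a₁, ∑ b₁, ∑ a₂, ∑ b₂, ∑ a₃, ∑ b₃, ∑ a₄,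
      f (ofEntries a₀ b₀ a₁ b₁ a₂ b₂ a₃ b₃ a₄) := by
  rw [Fintype.sum_cons_get, Fintype.sum_fin_two_arrow]
  refine Fintype.sum_congr _ _ fun a₀ => Fintype.sum_congr _ _ fun b₀ => ?_
  rw [Fintype.sum_cons_get, Fintype.sum_fin_two_arrow]
  refine Fintype.sum_congr _ _ fun a₁ => Fintype.sum_congr _ _ fun b₁ => ?_
  rw [Fintype.sum_cons_get, Fintype.sum_fin_two_arrow]
  refine Fintype.sum_congr _ _ fun a₂ => Fintype.sum_congr _ _ fun b₂ => ?_
  rw [Fintype.sum_cons_get, Fintype.sum_fin_two_arrow]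
  refine Fintype.sum_congr _ _ fun a₃ => Fintype.sum_congr _ _ fun b₃ => ?_
  rw [Fintype.sum_cons_get, Fintype.sum_fin_one_arrow]
  refine Fintype.sum_congr _ _ fun a₄ => ?_
  refine (Fintype.sum_subsingleton _ (fun i : Fin 0 => i.elim0)).trans ?_
  congr 1
  funext i
  match i with
  | 0 => rfl
  | 1 => rfl
  | 2 => rfl
  | 3 => rfl
  | 4 => rfl

theorem Filling.sum_entries {M : Type*} [AddCommMonoid M] {n : ℕ} (g : Fin n → M)
    (a₀ b₀ a₁ b₁ a₂ b₂ a₃ b₃ a₄ : Fin n) :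
    ∑ i, ∑ j, g (ofEntries a₀ b₀ a₁ b₁ a₂ b₂ a₃ b₃ a₄ i j) =
      g a₀ + (g b₀ + (g a₁ + (g b₁ + (g a₂ + (g b₂ + (g a₃ + (g b₃ + g a₄))))))) := by
  trans (g a₀ + g b₀) + ((g a₁ + g b₁) + ((g a₂ + g b₂) + ((g a₃ + g b₃) + g a₄)))
  · refine (Fin.sum_univ_succ (n := 4) _).trans (congrArg₂ _ (Fin.sum_univ_two _) ?_)
    refine (Fin.sum_univ_succ (n := 3) _).trans (congrArg₂ _ (Fin.sum_univ_two _) ?_)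
    refine (Fin.sum_univ_succ (n := 2) _).trans (congrArg₂ _ (Fin.sum_univ_two _) ?_)
    refine (Fin.sum_univ_succ (n := 1) _).trans (congrArg₂ _ (Fin.sum_univ_two _) ?_)
    exact (Fin.sum_univ_one _).trans (Fin.sum_univ_one _)
  · simp only [add_assoc]

theorem Filling.isSemistandard_ofEntries {n : ℕ} (a₀ b₀ a₁ b₁ a₂ b₂ a₃ b₃ a₄ : Fin n) :
    (ofEntries a₀ b₀ a₁ b₁ a₂ b₂ a₃ b₃ a₄).IsSemistandard ↔
      a₀ ≤ b₀ ∧ a₀ < a₁ ∧ (b₀ < b₁ ∧ a₁ ≤ b₁) ∧ a₁ < a₂ ∧ (b₁ < b₂ ∧ a₂ ≤ b₂) ∧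
        a₂ < a₃ ∧ (b₂ < b₃ ∧ a₃ ≤ b₃) ∧ a₃ < a₄ := by
  constructor
  · rintro ⟨h, h'⟩
    exact ⟨h 0 (0 : Fin 2) (1 : Fin 2) (by decide),
      h' 0 1 (by decide) ⟨0, two_pos⟩ two_pos,
      ⟨h' 0 1 (by decide) ⟨1, one_lt_two⟩ one_lt_two, h 1 (0 : Fin 2) (1 : Fin 2) (by decide)⟩,
      h' 1 2 (by decide) ⟨0, two_pos⟩ two_pos,
      ⟨h' 1 2 (by decide) ⟨1, one_lt_two⟩ one_lt_two, h 2 (0 : Fin 2) (1 : Fin 2) (by decide)⟩,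
      h' 2 3 (by decide) ⟨0, two_pos⟩ two_pos,
      ⟨h' 2 3 (by decide) ⟨1, one_lt_two⟩ one_lt_two, h 3 (0 : Fin 2) (1 : Fin 2) (by decide)⟩,
      h' 3 4 (by decide) ⟨0, one_pos⟩ two_pos⟩
  · rintro ⟨h1, h2, ⟨h3, h4⟩, h5, ⟨h6, h7⟩, h8, ⟨h9, h10⟩, h11⟩
    refine ⟨?_, ?_⟩
    · have two {a b : Fin n} (h : a ≤ b) :
          ∀ j j' : Fin 2, (j : ℕ) ≤ j' → ![a, b] j ≤ ![a, b] j' := by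
        intro j j' hj
        fin_cases j <;> fin_cases j' <;> simp_all
      intro i
      match i with
      | 0 => exact two h1
      | 1 => exact two h4
      | 2 => exact two h7
      | 3 => exact two h10
      | 4 => exact fun j j' _ => (congrArg _ (Subsingleton.elim (α := Fin 1) j j')).le
    · have two {a b c d : Fin n} (h : a < c) (h' : b < d) : ∀ j : Fin 2, ![a, b] j < ![c, d] j := by
        intro j
        fin_cases j <;> assumption
      have one {a b c : Fin n} (h : a < c) :
          ∀ (j : Fin 1) (hj : (j : ℕ) < 2), ![a, b] ⟨j, hj⟩ < ![c] j := by
        intro j hj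
        fin_cases j; exact h
      intro i i' hi
      match i, i' with
      | 0, 1 => exact fun j _ => two h2 h3 j
      | 0, 2 => exact fun j _ => two (h2.trans h5) (h3.trans h6) j
      | 0, 3 => exact fun j _ => two (h2.trans (h5.trans h8)) (h3.trans (h6.trans h9)) j
      | 0, 4 => exact one (h2.trans (h5.trans (h8.trans h11)))
      | 1, 2 => exact fun j _ => two h5 h6 j
      | 1, 3 => exact fun j _ => two (h5.trans h8) (h6.trans h9) j
      | 1, 4 => exact one (h5.trans (h8.trans h11))
      | 2, 3 => exact fun j _ => two h8 h9 j
      | 2, 4 => exact one (h8.trans h11)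
      | 3, 4 => exact one h11
      | 0, 0 | 1, 0 | 1, 1 | 2, 0 | 2, 1 | 2, 2 | 3, 0 | 3, 1 | 3, 2 |
        3, 3 | 4, 0 | 4, 1 | 4, 2 | 4, 3 | 4, 4 =>
        exact absurd hi (by decide)

/-- The number of cells of `T` with entry `k`. -/
def Filling.content {lam : List ℕ} {n : ℕ} (T : Filling lam n) (k : Fin n) : ℕ :=
  ∑ i, ∑ j, if T i j = k then 1 else 0

theorem Filling.sum_entries_eq_sum_content {R : Type*} [CommSemiring R] {lam : List ℕ} {n : ℕ}
    (T : Filling lam n) (g : Fin n → R) : ∑ i, ∑ j, g (T i j) = ∑ k, (T.content k : R) * g k := by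
  have h (i) (j : Fin (lam.get i)) : g (T i j) = ∑ k, (if T i j = k then 1 else 0) * g k := by
    simp
  simp_rw [h, content, Nat.cast_sum, Nat.cast_ite, Nat.cast_one, Nat.cast_zero, Finset.sum_mul]
  rw [Finset.sum_comm]
  exact Finset.sum_congr rfl fun i _ => Finset.sum_comm

theorem Filling.sum_content {n : ℕ} (T : Filling [2, 2, 2, 2, 1] n) : ∑ k, T.content k = 9 := by
  have h := T.sum_entries_eq_sum_content (R := ℕ) (fun _ => 1)
  simp only [Nat.cast_id, mul_one] at h
  rw [← h]
  simp only [Finset.sum_const, Finset.card_univ, Fintype.card_fin, smul_eq_mul, mul_one]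
  rfl

/-- The sum of `g` over `{0, …, 8}`, in a form that reduces quickly in the kernel. -/
def sumNine (g : ℕ → ℕ) : ℕ := g 0 + (g 1 + (g 2 + (g 3 + (g 4 + (g 5 + (g 6 + (g 7 + g 8)))))))

theorem sumNine_eq (g : ℕ → ℕ) : sumNine g = ∑ i : Fin 9, g i := by
  simp [sumNine, Fin.sum_univ_succ]

/-- The sum of `f` over the semistandard tableaux of shape `(2, 2, 2, 2, 1)` with entries in
`{0, …, 8}`, in a form that reduces quickly in the kernel. -/
def tableauSum (f : ℕ → ℕ → ℕ → ℕ → ℕ → ℕ → ℕ → ℕ → ℕ → ℕ) : ℕ :=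
  sumNine fun a₀ => sumNine fun b₀ => bif a₀.ble b₀ then
  sumNine fun a₁ => bif a₀.blt a₁ then sumNine fun b₁ => bif b₀.blt b₁ && a₁.ble b₁ then
  sumNine fun a₂ => bif a₁.blt a₂ then sumNine fun b₂ => bif b₁.blt b₂ && a₂.ble b₂ then
  sumNine fun a₃ => bif a₂.blt a₃ then sumNine fun b₃ => bif b₂.blt b₃ && a₃.ble b₃ then
  sumNine fun a₄ => bif a₃.blt a₄ then f a₀ b₀ a₁ b₁ a₂ b₂ a₃ b₃ a₄ else 0
  else 0 else 0 else 0 else 0 else 0 else 0 else 0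

open scoped Classical in
theorem tableauSum_eq (f : ℕ → ℕ → ℕ → ℕ → ℕ → ℕ → ℕ → ℕ → ℕ → ℕ)
    (F : Filling [2, 2, 2, 2, 1] 9 → ℕ)
    (hF : ∀ a₀ b₀ a₁ b₁ a₂ b₂ a₃ b₃ a₄, F (.ofEntries a₀ b₀ a₁ b₁ a₂ b₂ a₃ b₃ a₄) =
      f a₀ b₀ a₁ b₁ a₂ b₂ a₃ b₃ a₄) :
    ∑ T with T.IsSemistandard, F T = tableauSum f := by
  rw [Finset.sum_filter, Filling.sum_eq]
  simp only [tableauSum, sumNine_eq, Bool.cond_eq_ite, Bool.and_eq_true, Nat.ble_eq, Nat.blt_eq,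
    Finset.ite_sum_zero, ← ite_and, Filling.isSemistandard_ofEntries, hF,
    Fin.val_fin_le, Fin.val_fin_lt]

open scoped Classical in
theorem tableauSum_pow_mul_pow (x y : ℕ) :
    tableauSum (fun a₀ b₀ a₁ b₁ a₂ b₂ a₃ b₃ a₄ =>
      (x ^ a₀ + (x ^ b₀ + (x ^ a₁ + (x ^ b₁ + (x ^ a₂ +
        (x ^ b₂ + (x ^ a₃ + (x ^ b₃ + x ^ a₄)))))))) *
      (y ^ a₀ + (y ^ b₀ + (y ^ a₁ + (y ^ b₁ + (y ^ a₂ +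
        (y ^ b₂ + (y ^ a₃ + (y ^ b₃ + y ^ a₄))))))))) =
    ∑ j : Fin 9, (∑ i : Fin 9, (∑ T : Filling [2, 2, 2, 2, 1] 9 with T.IsSemistandard,
      T.content i * T.content j) * x ^ (i : ℕ)) * y ^ (j : ℕ) := by
  rw [← tableauSum_eq _ (fun T => (∑ i, ∑ j, x ^ (T i j : ℕ)) * (∑ i, ∑ j, y ^ (T i j : ℕ)))
    (fun a₀ b₀ a₁ b₁ a₂ b₂ a₃ b₃ a₄ =>
      congrArg₂ _ (Filling.sum_entries (fun k : Fin 9 => x ^ (k : ℕ)) ..)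
        (Filling.sum_entries (fun k : Fin 9 => y ^ (k : ℕ)) ..))]
  simp_rw [fun T : Filling [2, 2, 2, 2, 1] 9 =>
      T.sum_entries_eq_sum_content (fun k : Fin 9 => x ^ (k : ℕ)),
    fun T : Filling [2, 2, 2, 2, 1] 9 =>
      T.sum_entries_eq_sum_content (fun k : Fin 9 => y ^ (k : ℕ)), Nat.cast_id, Finset.sum_mul]
  simp_rw [Finset.mul_sum]
  rw [Finset.sum_comm]
  conv_rhs => rw [Finset.sum_comm]
  refine Finset.sum_congr rfl fun i _ => ?_
  rw [Finset.sum_comm]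
  exact Finset.sum_congr rfl fun j _ => Finset.sum_congr rfl fun T _ => by ring

set_option maxRecDepth 100000 in
theorem tableauSum_pack : tableauSum (fun a₀ b₀ a₁ b₁ a₂ b₂ a₃ b₃ a₄ =>
    ((2 ^ 36) ^ a₀ + ((2 ^ 36) ^ b₀ + ((2 ^ 36) ^ a₁ + ((2 ^ 36) ^ b₁ + ((2 ^ 36) ^ a₂ +
      ((2 ^ 36) ^ b₂ + ((2 ^ 36) ^ a₃ + ((2 ^ 36) ^ b₃ + (2 ^ 36) ^ a₄)))))))) *
    ((2 ^ 324) ^ a₀ + ((2 ^ 324) ^ b₀ + ((2 ^ 324) ^ a₁ + ((2 ^ 324) ^ b₁ + ((2 ^ 324) ^ a₂ +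
      ((2 ^ 324) ^ b₂ + ((2 ^ 324) ^ a₃ + ((2 ^ 324) ^ b₃ + (2 ^ 324) ^ a₄))))))))) =
    sumNine fun j => (sumNine fun i => (bif i.beq j then 13524 else 8232) * (2 ^ 36) ^ i) *
      (2 ^ 324) ^ j := by
  decide +kernel

theorem eq_of_sum_mul_pow_eq {n b : ℕ} {c d : Fin n → ℕ} (hc : ∀ i, c i < b) (hd : ∀ i, d i < b)
    (h : ∑ i, c i * b ^ (i : ℕ) = ∑ i, d i * b ^ (i : ℕ)) : c = d := by
  have h' : finFunctionFinEquiv (fun i => (⟨c i, hc i⟩ : Fin b)) =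
      finFunctionFinEquiv (fun i => (⟨d i, hd i⟩ : Fin b)) := by
    ext; simpa [finFunctionFinEquiv_apply] using h
  funext i
  simpa using congrFun (finFunctionFinEquiv.injective h') i

theorem sum_mul_pow_lt {n b : ℕ} {c : Fin n → ℕ} (hc : ∀ i, c i < b) :
    ∑ i, c i * b ^ (i : ℕ) < b ^ n := by
  simpa [finFunctionFinEquiv_apply] using
    (finFunctionFinEquiv (fun i => (⟨c i, hc i⟩ : Fin b))).isLt

set_option exponentiation.threshold 324 in
open scoped Classical in
theorem sum_content_mul_content (i j : Fin 9) :
    ∑ T : Filling [2, 2, 2, 2, 1] 9 with T.IsSemistandard, T.content i * T.content j =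
      if i = j then 13524 else 8232 := by
  set q : Fin 9 → Fin 9 → ℕ := fun i j =>
    ∑ T : Filling [2, 2, 2, 2, 1] 9 with T.IsSemistandard, T.content i * T.content j
  have hle (T : Filling [2, 2, 2, 2, 1] 9) (i : Fin 9) : T.content i ≤ 9 :=
    (Finset.single_le_sum (fun _ _ => Nat.zero_le _) (Finset.mem_univ i)).trans_eq T.sum_content
  have hcard : Fintype.card (Filling [2, 2, 2, 2, 1] 9) = 9 ^ 9 := by
    rw [Fintype.card_pi]
    simp only [Fintype.card_pi, Finset.prod_const, Finset.card_univ, Fintype.card_fin]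
    rw [Finset.prod_pow_eq_pow_sum]
    rfl
  have hlt (i j) : q i j < 2 ^ 36 := by
    calc q i j ≤ ∑ T : Filling [2, 2, 2, 2, 1] 9, T.content i * T.content j :=
          Finset.sum_le_sum_of_subset (Finset.filter_subset _ _)
      _ ≤ ∑ T : Filling [2, 2, 2, 2, 1] 9, 9 * 9 :=
          Finset.sum_le_sum fun T _ => Nat.mul_le_mul (hle T i) (hle T j)
      _ < 2 ^ 36 := by
          rw [Finset.sum_const, Finset.card_univ, hcard]; norm_num
  have key : ∑ j : Fin 9, (∑ i : Fin 9, q i j * (2 ^ 36) ^ (i : ℕ)) * ((2 ^ 36) ^ 9) ^ (j : ℕ) =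
      ∑ j : Fin 9, (∑ i : Fin 9, (if i = j then 13524 else 8232) * (2 ^ 36) ^ (i : ℕ)) *
        ((2 ^ 36) ^ 9) ^ (j : ℕ) := by
    have h := tableauSum_pack
    rw [tableauSum_pow_mul_pow] at h
    simp only [sumNine_eq, Bool.cond_eq_ite, Nat.beq_eq, Fin.val_inj, -Nat.reducePow] at h
    rw [← pow_mul 2 36 9]
    exact h
  have h₂ := eq_of_sum_mul_pow_eq (fun j => sum_mul_pow_lt fun i => hlt i j)
    (fun j => sum_mul_pow_lt fun i => by split_ifs <;> norm_num) key
  exact congrFun (eq_of_sum_mul_pow_eq (fun i => hlt i j)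
    (fun i => by split_ifs <;> norm_num) (congrFun h₂ j)) i

open scoped Classical in
theorem sum_content (i : Fin 9) :
    ∑ T : Filling [2, 2, 2, 2, 1] 9 with T.IsSemistandard, T.content i = 8820 := by
  have h : ∑ j, ∑ T : Filling [2, 2, 2, 2, 1] 9 with T.IsSemistandard,
      T.content i * T.content j = 79380 := by
    simp_rw [sum_content_mul_content]
    revert i
    decide
  rw [Finset.sum_comm] at h
  simp_rw [← Finset.mul_sum, Filling.sum_content] at h
  rw [← Finset.sum_mul] at h
  omega

/-- `c₂(γ9^[2, 2, 2, 2, 1]) = 5292·c₂(γ9)`: the second elementary symmetric function of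
the multiset of weights of semistandard Young tableaux of shape `[2, 2, 2, 2, 1]` with
entries in `{0, …, 8}` is congruent to `5292·e₂` modulo the ideal generated
by `e₁`. -/
theorem c2_ssyt_stmt17 :
    Multiset.esymm (ssytWeights [2, 2, 2, 2, 1] 9) 2 - 5292 * esymm (Fin 9) ℤ 2
      ∈ Ideal.span {esymm (Fin 9) ℤ 1} := by
  classical
  have hw (T : Filling [2, 2, 2, 2, 1] 9) : ∑ i, ∑ j, (X (T i j) : MvPolynomial (Fin 9) ℤ) =
    ∑ k, (T.content k : MvPolynomial (Fin 9) ℤ) * X k := T.sum_entries_eq_sum_content _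
  have hW : ssytWeights [2, 2, 2, 2, 1] 9 =
      (Finset.univ.filter fun T : Filling [2, 2, 2, 2, 1] 9 => T.IsSemistandard).val.map
        fun T => ∑ k, (T.content k : MvPolynomial (Fin 9) ℤ) * X k := by
    simp_rw [← hw]
    unfold ssytWeights Filling.IsSemistandard
    congr!
  have h₁ : (ssytWeights [2, 2, 2, 2, 1] 9).sum = 8820 * ∑ k, X k := by
    rw [hW]
    change ∑ T : Filling [2, 2, 2, 2, 1] 9 with T.IsSemistandard, _ = _
    rw [Finset.sum_comm, Finset.mul_sum]
    refine Finset.sum_congr rfl fun k _ => ?_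
    rw [← Finset.sum_mul, ← Nat.cast_sum, sum_content, Nat.cast_ofNat]
  have h₂ : ((ssytWeights [2, 2, 2, 2, 1] 9).map (· ^ 2)).sum =
      5292 * ∑ k, X k ^ 2 + 8232 * (∑ k, X k) ^ 2 := by
    rw [hW, Multiset.map_map]
    change ∑ T : Filling [2, 2, 2, 2, 1] 9 with T.IsSemistandard,
      (∑ k, (T.content k : MvPolynomial (Fin 9) ℤ) * X k) ^ 2 = _
    have h (T : Filling [2, 2, 2, 2, 1] 9) : (∑ k, (T.content k : MvPolynomial (Fin 9) ℤ) * X k) ^ 2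
        = ∑ i, ∑ j, ((T.content i * T.content j : ℕ) : MvPolynomial (Fin 9) ℤ) * (X i * X j) := by
      rw [sq, Finset.sum_mul_sum]
      refine Finset.sum_congr rfl fun i _ => Finset.sum_congr rfl fun j _ => ?_
      push_cast
      ring
    simp_rw [h]
    rw [Finset.sum_comm]
    have h' (i : Fin 9) : ∑ T : Filling [2, 2, 2, 2, 1] 9 with T.IsSemistandard,
        ∑ j, ((T.content i * T.content j : ℕ) : MvPolynomial (Fin 9) ℤ) * (X i * X j) =
        5292 * X i ^ 2 + 8232 * (X i * ∑ j, X j) := by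
      rw [Finset.sum_comm]
      simp_rw [← Finset.sum_mul, ← Nat.cast_sum, sum_content_mul_content]
      have h'' (j : Fin 9) : ((if i = j then 13524 else 8232 : ℕ) : MvPolynomial (Fin 9) ℤ) *
          (X i * X j) = (if i = j then 5292 * (X i * X j) else 0) + 8232 * (X i * X j) := by
        split_ifs <;> push_cast <;> ring
      simp_rw [h'', Finset.sum_add_distrib, Finset.sum_ite_eq, Finset.mem_univ, if_true,
        Finset.mul_sum, sq]
    simp_rw [h', Finset.sum_add_distrib, ← Finset.mul_sum, ← Finset.sum_mul, ← sq]
  have he₁ : esymm (Fin 9) ℤ 1 = ∑ k, X k := by simp [esymm_one]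
  have he₂ : 2 * esymm (Fin 9) ℤ 2 = (∑ k, X k) ^ 2 - ∑ k, X k ^ 2 := by
    rw [esymm_eq_multiset_esymm, Multiset.two_mul_esymm_two, Multiset.map_map]
    rfl
  have h := Multiset.two_mul_esymm_two (ssytWeights [2, 2, 2, 2, 1] 9)
  rw [h₁, h₂] at h
  rw [Ideal.mem_span_singleton, he₁]
  refine ⟨38889438 * ∑ k, X k, mul_left_cancel₀ (two_ne_zero' (MvPolynomial (Fin 9) ℤ)) ?_⟩
  linear_combination h - 5292 * he₂
end

section
/- In R = MvPolynomial (Fin 9) ℤ, the second elementary symmetric function of the multiset W((2,2,1,1,1,1,1), 9) of weights of semistandard Young tableaux of shape (2,2,1,1,1,1,1) with entries in {0,…,8} is congruent to 486·e₂ modulo the ideal generated by e₁; equivalently, c₂(γ₉^{(2,2,1,1,1,1,1)}) = 486·c₂(γ₉), the Table 2 entry for the weight α₂+α₇ of SL₉/μ₃. -/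
open MvPolynomial

/-- The strictly increasing sequence `0, 1, …, 8` with the values `p` and `q + 1` left out
(where `p ≤ q`). -/
def columnEntry (p q : Fin 8) (i : ℕ) : Fin 9 :=
  Fin.ofNat 9 (i + (if p.val ≤ i then 1 else 0) + (if q.val ≤ i then 1 else 0))

/-- The quadruples `(p, q, b, c)` encoding tableaux with first column `columnEntry p q` and
second column `b < c`. -/
def IsTableauCode (t : Fin 8 × Fin 8 × Fin 9 × Fin 9) : Prop :=
  t.1 ≤ t.2.1 ∧ t.2.2.1 < t.2.2.2 ∧ columnEntry t.1 t.2.1 0 ≤ t.2.2.1 ∧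
    columnEntry t.1 t.2.1 1 ≤ t.2.2.2

instance : DecidablePred IsTableauCode := fun t => by
  unfold IsTableauCode; infer_instance

/-- The filling encoded by a quadruple. -/
def tableauOfCode (t : Fin 8 × Fin 8 × Fin 9 × Fin 9)
    (i : Fin [2, 2, 1, 1, 1, 1, 1].length) (j : Fin ([2, 2, 1, 1, 1, 1, 1].get i)) : Fin 9 :=
  if j.val = 0 then columnEntry t.1 t.2.1 i.val else if i.val = 0 then t.2.2.1 else t.2.2.2

theorem columnEntry_val (p q : Fin 8) (i : Fin 7) :
    (columnEntry p q i).val =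
      i.val + (if p.val ≤ i.val then 1 else 0) + (if q.val ≤ i.val then 1 else 0) := by
  simp only [columnEntry, Fin.ofNat]
  split_ifs <;> omega

theorem columnEntry_strictMono (p q : Fin 8) (i j : Fin 7) (hij : i < j) :
    columnEntry p q i < columnEntry p q j := by
  rw [Fin.lt_def, columnEntry_val, columnEntry_val]
  split_ifs <;> omega

theorem columnEntry_injective (p q p' q' : Fin 8) (hpq : p ≤ q) (hpq' : p' ≤ q')
    (h : ∀ i : Fin 7, columnEntry p q i = columnEntry p' q' i) : p = p' ∧ q = q' := by
  have hval : ∀ i : ℕ, i < 7 →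
      (if p.val ≤ i then 1 else 0) + (if q.val ≤ i then 1 else 0) =
        (if p'.val ≤ i then 1 else 0) + (if q'.val ≤ i then 1 else 0) := by
    intro i hi
    have := congrArg Fin.val (h ⟨i, hi⟩)
    rw [columnEntry_val, columnEntry_val] at this
    simp only at this
    omega
  have hp : p = p' := by
    rcases lt_trichotomy p p' with hlt | heq | hlt
    · have := hval p (by omega)
      split_ifs at this <;> omega
    · exact heq
    · have := hval p' (by omega)
      split_ifs at this <;> omega
  subst hp
  refine ⟨rfl, ?_⟩
  rcases lt_trichotomy q q' with hlt | heq | hlt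
  · have := hval q (by omega)
    split_ifs at this <;> omega
  · exact heq
  · have := hval q' (by omega)
    split_ifs at this <;> omega

/-- An up-closed predicate on `Fin n` holds exactly from some threshold on. -/
theorem exists_threshold {n : ℕ} (P : Fin n → Prop) (hP : ∀ i j, i ≤ j → P i → P j) :
    ∃ p : Fin (n + 1), ∀ i, p.val ≤ i.val ↔ P i := by
  classical
  have hex : ∃ m : ℕ, ∀ i : Fin n, m ≤ i.val → P i := ⟨n, fun i hi => by omega⟩
  refine ⟨⟨Nat.find hex, Nat.lt_succ_of_le (Nat.find_min' hex fun i hi => by omega)⟩,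
    fun i => ⟨Nat.find_spec hex i, fun hi => Nat.find_min' hex fun j hj => hP i j hj hi⟩⟩

theorem exists_columnEntry (a : Fin 7 → Fin 9) (ha : StrictMono a) :
    ∃ p q : Fin 8, p ≤ q ∧ ∀ i : Fin 7, columnEntry p q i = a i := by
  have hstep : ∀ i j : Fin 7, i ≤ j → (a i).val + (j.val - i.val) ≤ (a j).val := by
    intro i j hij
    have h0 : a 0 < a 1 := ha (by decide)
    have h1 : a 1 < a 2 := ha (by decide)
    have h2 : a 2 < a 3 := ha (by decide)
    have h3 : a 3 < a 4 := ha (by decide)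
    have h4 : a 4 < a 5 := ha (by decide)
    have h5 : a 5 < a 6 := ha (by decide)
    fin_cases i <;> fin_cases j <;> simp at hij ⊢ <;> omega
  obtain ⟨p, hp⟩ := exists_threshold (fun i => i.val + 1 ≤ (a i).val)
    (fun i j hij h => by have := hstep i j hij; omega)
  obtain ⟨q, hq⟩ := exists_threshold (fun i => i.val + 2 ≤ (a i).val)
    (fun i j hij h => by have := hstep i j hij; omega)
  refine ⟨p, q, ?_, fun i => ?_⟩
  · by_contra! hlt
    have hlt' : q.val < p.val := hlt
    have h1 := hp ⟨q.val, by omega⟩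
    have h2 := hq ⟨q.val, by omega⟩
    simp only at h1 h2
    omega
  · have h0 := hstep 0 i (Fin.zero_le i)
    have h6 := hstep i 6 (by omega)
    have hp := hp i
    have hq := hq i
    apply Fin.ext
    simp only [columnEntry, Fin.ofNat]
    simp at h0 h6
    split_ifs <;> omega

/-- The weight of the tableau encoded by a quadruple. -/
noncomputable def codeWeight (t : Fin 8 × Fin 8 × Fin 9 × Fin 9) : MvPolynomial (Fin 9) ℤ :=
  ∑ i : Fin 7, X (columnEntry t.1 t.2.1 i) + X t.2.2.1 + X t.2.2.2

theorem sum_X_tableauOfCode (t : Fin 8 × Fin 8 × Fin 9 × Fin 9) :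
    ∑ i, ∑ j, (X (tableauOfCode t i j) : MvPolynomial (Fin 9) ℤ) = codeWeight t := by
  simp [codeWeight, tableauOfCode, Fin.sum_univ_succ]
  ring

theorem ssytWeights_eq :
    ssytWeights [2, 2, 1, 1, 1, 1, 1] 9 =
      (Finset.univ.filter IsTableauCode).val.map codeWeight := by
  classical
  have hinj : Set.InjOn tableauOfCode (Finset.univ.filter IsTableauCode : Finset _) := by
    rintro ⟨p, q, b, c⟩ h ⟨p', q', b', c'⟩ h' e
    simp only [Finset.coe_filter, Finset.mem_univ, true_and, Set.mem_ofPred_eq] at h h'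
    have hb := congrFun (congrFun e (0 : Fin 7)) (1 : Fin 2)
    have hc := congrFun (congrFun e (1 : Fin 7)) (1 : Fin 2)
    simp [tableauOfCode] at hb hc
    obtain ⟨rfl, rfl⟩ := columnEntry_injective p q p' q' h.1 h'.1 (fun i => by
      have := congrFun (congrFun e i) ⟨0, by fin_cases i <;> decide⟩
      simpa [tableauOfCode] using this)
    simp [hb, hc]
  unfold ssytWeights
  rw [← funext sum_X_tableauOfCode]
  rw [← Function.comp_def (fun T : (i : Fin [2, 2, 1, 1, 1, 1, 1].length) →
    Fin ([2, 2, 1, 1, 1, 1, 1].get i) → Fin 9 =>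
      ∑ i, ∑ j, (X (T i j) : MvPolynomial (Fin 9) ℤ)) tableauOfCode]
  rw [← Multiset.map_map, ← Finset.image_val_of_injOn hinj]
  refine congrArg (fun S : Finset _ => S.val.map _) ?_
  ext T
  simp only [Finset.mem_filter, Finset.mem_univ, true_and, Finset.mem_image]
  constructor
  · rintro ⟨hrow, hcol⟩
    have hpos : ∀ i : Fin 7, 0 < [2, 2, 1, 1, 1, 1, 1].get i := by decide
    obtain ⟨p, q, hpq, ha⟩ := exists_columnEntry (fun i => T i ⟨0, hpos i⟩)
      (fun i i' hi => hcol i i' hi ⟨0, hpos i'⟩ (hpos i))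
    refine ⟨(p, q, T (0 : Fin 7) (1 : Fin 2), T (1 : Fin 7) (1 : Fin 2)), ⟨hpq, ?_, ?_, ?_⟩, ?_⟩
    · exact hcol (0 : Fin 7) (1 : Fin 7) (by decide) (1 : Fin 2) (by decide)
    · exact (ha 0).trans_le (hrow (0 : Fin 7) (0 : Fin 2) (1 : Fin 2) (by decide))
    · exact (ha 1).trans_le (hrow (1 : Fin 7) (0 : Fin 2) (1 : Fin 2) (by decide))
    · funext i j
      by_cases hj : j.val = 0
      · obtain rfl : j = ⟨0, hpos i⟩ := Fin.ext hj
        simpa [tableauOfCode] using ha i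
      · have hlen : ∀ i : Fin 7, ∀ j : Fin ([2, 2, 1, 1, 1, 1, 1].get i), j.val ≠ 0 →
            (i = 0 ∨ i = 1) ∧ j.val = 1 := by decide
        obtain ⟨rfl | rfl, hj1⟩ := hlen i j hj
        · obtain rfl : j = (1 : Fin 2) := Fin.ext hj1
          rfl
        · obtain rfl : j = (1 : Fin 2) := Fin.ext hj1
          rfl
  · rintro ⟨⟨p, q, b, c⟩, ⟨hpq, hbc, hb, hc⟩, rfl⟩
    have hmono := columnEntry_strictMono p q
    have hlen : ∀ i : Fin 7, ∀ j : Fin ([2, 2, 1, 1, 1, 1, 1].get i), j.val ≠ 0 →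
      (i.val = 0 ∨ i.val = 1) ∧ j.val = 1 := by decide
    simp only at hbc hb hc
    constructor
    · intro i j j' hjj
      by_cases hj : j.val = 0 <;> by_cases hj' : j'.val = 0
      · simp [tableauOfCode, hj, hj']
      · obtain ⟨hi | hi, -⟩ := hlen i j' hj' <;> simp [tableauOfCode, hj, hj', hi, hb, hc]
      · omega
      · simp [tableauOfCode, hj, hj']
    · intro i i' hii j hj
      by_cases hj0 : j.val = 0
      · simpa [tableauOfCode, hj0] using hmono i i' hii
      · have h1 := (hlen i' j hj0).1
        have hi : i.val = 0 := by omega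
        have hi' : i'.val ≠ 0 := by omega
        simpa [tableauOfCode, hj0, hi, hi'] using hbc

/-- The multiplicity of the entry `k` in the tableau encoded by a quadruple. -/
def codeMult (t : Fin 8 × Fin 8 × Fin 9 × Fin 9) (k : Fin 9) : ℕ :=
  (if k.val = t.1.val ∨ k.val = t.2.1.val + 1 then 0 else 1) + (if k = t.2.2.1 then 1 else 0) +
    (if k = t.2.2.2 then 1 else 0)

/-- The sum of `f i` over `i < n`, in a form which evaluates quickly in the kernel. -/
def natSum (n : ℕ) (f : ℕ → ℕ) : ℕ :=
  Nat.rec 0 (fun i s => s + f i) n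

theorem sum_eq_natSum {n : ℕ} (F : Fin n → ℕ) (f : ℕ → ℕ) (h : ∀ i, F i = f i.val) :
    ∑ i, F i = natSum n f := by
  simp only [h]
  clear h
  induction n with
  | zero => rfl
  | succ n ih =>
    rw [Fin.sum_univ_castSucc]
    exact congrArg (· + f n) (ih fun _ => 0)

theorem sum_code_eq_natSum (F : Fin 8 × Fin 8 × Fin 9 × Fin 9 → ℕ) (f : ℕ → ℕ → ℕ → ℕ → ℕ)
    (h : ∀ t, F t = f t.1 t.2.1 t.2.2.1 t.2.2.2) :
    ∑ t ∈ Finset.univ.filter IsTableauCode, F t =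
      natSum 8 fun p => natSum 8 fun q => bif Nat.ble p q then
        natSum 9 fun b => bif Nat.ble ((bif Nat.ble p 0 then 1 else 0) +
            bif Nat.ble q 0 then 1 else 0) b then
          natSum 9 fun c => bif Nat.ble (b + 1) c && Nat.ble (1 + (bif Nat.ble p 1 then 1 else 0) +
              bif Nat.ble q 1 then 1 else 0) c then
            f p q b c else 0 else 0 else 0 := by
  have hble : ∀ m n, Nat.ble m n = decide (m ≤ n) := fun m n => by
    rw [Bool.eq_iff_iff]; simp
  simp only [Finset.sum_filter, Fintype.sum_prod_type, hble, Bool.cond_decide]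
  refine sum_eq_natSum _ _ fun p => sum_eq_natSum _ _ fun q => ?_
  have h0 := columnEntry_val p q 0
  have h1 := columnEntry_val p q 1
  simp only [Fin.val_zero, Fin.val_one, zero_add] at h0 h1
  rw [← h0, ← h1]
  by_cases hpq : p ≤ q
  · rw [if_pos (Fin.le_def.mp hpq)]
    refine sum_eq_natSum _ _ fun b => ?_
    by_cases hb : columnEntry p q 0 ≤ b
    · rw [if_pos (Fin.le_def.mp hb)]
      refine sum_eq_natSum _ _ fun c => ?_
      simp only [IsTableauCode, hpq, hb, true_and, h, ← Bool.decide_and, Bool.cond_decide,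
        Fin.lt_def, Fin.le_def, Nat.succ_le_iff]
    · rw [if_neg (mt Fin.le_def.mpr hb)]
      simp [IsTableauCode, hb]
  · rw [if_neg (mt Fin.le_def.mpr hpq)]
    simp [IsTableauCode, hpq]

/-- The multiplicities `codeMult`, in a form which evaluates quickly in the kernel. -/
def natMult (k p q b c : ℕ) : ℕ :=
  (bif Nat.beq k p || Nat.beq k (q + 1) then 0 else 1) + (bif Nat.beq k b then 1 else 0) +
    bif Nat.beq k c then 1 else 0

theorem codeMult_eq_natMult (t : Fin 8 × Fin 8 × Fin 9 × Fin 9) (k : Fin 9) :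
    codeMult t k = natMult k t.1 t.2.1 t.2.2.1 t.2.2.2 := by
  have hbeq : ∀ m n, Nat.beq m n = decide (m = n) := fun m n => by
    rw [Bool.eq_iff_iff]; simp
  simp only [codeMult, natMult, hbeq, ← Bool.decide_or, Bool.cond_decide, Fin.ext_iff]

theorem sum_columnEntry (p q : Fin 8) (hpq : p ≤ q) (k : Fin 9) :
    ∑ i : Fin 7, (if k = columnEntry p q i then 1 else 0) =
      if k.val = p.val ∨ k.val = q.val + 1 then 0 else 1 := by
  have hk : ∀ i : Fin 7, k = columnEntry p q i ↔ k.val =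
      i.val + (if p.val ≤ i.val then 1 else 0) + (if q.val ≤ i.val then 1 else 0) := fun i => by
    rw [Fin.ext_iff, columnEntry_val]
  have hpq' : p.val ≤ q.val := hpq
  simp only [hk]
  split_ifs with h
  · refine Finset.sum_eq_zero fun i _ => if_neg ?_
    split_ifs <;> omega
  · have hlt : k.val - (if p.val < k.val then 1 else 0) -
        (if q.val + 1 < k.val then 1 else 0) < 7 := by
      split_ifs <;> omega
    rw [Finset.sum_eq_single ⟨_, hlt⟩]
    · refine if_pos ?_
      simp only
      split_ifs <;> omega
    · intro i _ hi
      refine if_neg fun he => hi (Fin.ext ?_)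
      simp only
      split_ifs at he ⊢ <;> omega
    · exact fun hn => absurd (Finset.mem_univ _) hn

theorem codeWeight_eq (t : Fin 8 × Fin 8 × Fin 9 × Fin 9) (ht : IsTableauCode t) :
    codeWeight t = ∑ k, (codeMult t k : MvPolynomial (Fin 9) ℤ) * X k := by
  have hX : ∀ a : Fin 9, (X a : MvPolynomial (Fin 9) ℤ) =
      ∑ k, ((if k = a then 1 else 0 : ℕ) : MvPolynomial (Fin 9) ℤ) * X k := by
    intro a
    simp
  simp only [codeMult, Nat.cast_add, add_mul, Finset.sum_add_distrib, ← hX, codeWeight]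
  congr 2
  simp only [← sum_columnEntry t.1 t.2.1 ht.1, Nat.cast_sum, Finset.sum_mul]
  rw [Finset.sum_comm]
  simp only [← hX]

theorem sum_codeMult (k : Fin 9) :
    ∑ t ∈ Finset.univ.filter IsTableauCode, codeMult t k = 1215 := by
  rw [sum_code_eq_natSum _ (natMult k) fun t => codeMult_eq_natMult t k]
  revert k
  decide +kernel

theorem sum_codeMult_mul (k l : Fin 9) :
    ∑ t ∈ Finset.univ.filter IsTableauCode, codeMult t k * codeMult t l =
      1161 + if k = l then 486 else 0 := by
  wlog hkl : k ≤ l generalizing k l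
  · simpa only [mul_comm, eq_comm] using this l k (le_of_not_ge hkl)
  rw [sum_code_eq_natSum _ (fun p q b c => natMult k p q b c * natMult l p q b c)
    fun t => by simp only [codeMult_eq_natMult]]
  revert k l
  decide +kernel

theorem sum_codeWeight :
    ∑ t ∈ Finset.univ.filter IsTableauCode, codeWeight t =
      1215 * ∑ k, (X k : MvPolynomial (Fin 9) ℤ) := by
  rw [Finset.sum_congr rfl fun t ht => codeWeight_eq t (Finset.mem_filter.mp ht).2,
    Finset.sum_comm, Finset.mul_sum]
  refine Finset.sum_congr rfl fun k _ => ?_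
  rw [← Finset.sum_mul, ← Nat.cast_sum, sum_codeMult]
  norm_cast

theorem sum_codeWeight_sq :
    ∑ t ∈ Finset.univ.filter IsTableauCode, codeWeight t ^ 2 =
      1161 * (∑ k, (X k : MvPolynomial (Fin 9) ℤ)) ^ 2 + 486 * ∑ k, X k ^ 2 := by
  have hsq : ∀ t ∈ Finset.univ.filter IsTableauCode, codeWeight t ^ 2 =
      ∑ k, ∑ l, ((codeMult t k * codeMult t l : ℕ) : MvPolynomial (Fin 9) ℤ) * (X k * X l) := by
    intro t ht
    rw [codeWeight_eq t (Finset.mem_filter.mp ht).2, sq, Finset.sum_mul_sum]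
    refine Finset.sum_congr rfl fun k _ => Finset.sum_congr rfl fun l _ => ?_
    push_cast
    ring
  rw [Finset.sum_congr rfl hsq, Finset.sum_comm]
  have hk : ∀ k : Fin 9, ∑ t ∈ Finset.univ.filter IsTableauCode,
      ∑ l, ((codeMult t k * codeMult t l : ℕ) : MvPolynomial (Fin 9) ℤ) * (X k * X l) =
        1161 * ∑ l, X k * X l + 486 * X k ^ 2 := by
    intro k
    rw [Finset.sum_comm]
    simp only [← Finset.sum_mul, ← Nat.cast_sum, sum_codeMult_mul]
    simp [add_mul, Finset.sum_add_distrib, Finset.mul_sum, sq]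
  simp only [hk, Finset.sum_add_distrib, ← Finset.mul_sum]
  rw [sq (∑ k, (X k : MvPolynomial (Fin 9) ℤ)), Finset.sum_mul]

/-- `c₂(γ9^[2, 2, 1, 1, 1, 1, 1]) = 486·c₂(γ9)`: the second elementary symmetric function of
the multiset of weights of semistandard Young tableaux of shape `[2, 2, 1, 1, 1, 1, 1]` with
entries in `{0, …, 8}` is congruent to `486·e₂` modulo the ideal generated
by `e₁`. -/
theorem c2_ssyt_stmt18 :
    Multiset.esymm (ssytWeights [2, 2, 1, 1, 1, 1, 1] 9) 2 - 486 * esymm (Fin 9) ℤ 2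
      ∈ Ideal.span {esymm (Fin 9) ℤ 1} := by
  have hW := Multiset.two_mul_esymm_two (ssytWeights [2, 2, 1, 1, 1, 1, 1] 9)
  have he := Multiset.two_mul_esymm_two
    (Finset.univ.val.map (X : Fin 9 → MvPolynomial (Fin 9) ℤ))
  rw [ssytWeights_eq, Multiset.map_map] at hW
  rw [← esymm_eq_multiset_esymm, Multiset.map_map] at he
  change _ = (∑ t ∈ Finset.univ.filter IsTableauCode, codeWeight t) ^ 2 -
    ∑ t ∈ Finset.univ.filter IsTableauCode, codeWeight t ^ 2 at hW
  change _ = (∑ k, (X k : MvPolynomial (Fin 9) ℤ)) ^ 2 - ∑ k, X k ^ 2 at he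
  rw [sum_codeWeight, sum_codeWeight_sq] at hW
  rw [← ssytWeights_eq] at hW
  rw [Ideal.mem_span_singleton, esymm_one]
  refine ⟨737289 * ∑ k, X k, ?_⟩
  refine mul_left_cancel₀ (two_ne_zero (α := MvPolynomial (Fin 9) ℤ)) ?_
  linear_combination hW - 486 * he
end

section
/- In R = MvPolynomial (Fin 9) ℤ, the second elementary symmetric function of the multiset W((3,3,3,3,3,3,3,3), 9) of weights of semistandard Young tableaux of shape (3,3,3,3,3,3,3,3) with entries in {0,…,8} is congruent to 66·e₂ modulo the ideal generated by e₁; equivalently, c₂(γ₉^{(3,3,3,3,3,3,3,3)}) = 66·c₂(γ₉), the Table 2 entry for the weight 3α₈ of SL₉/μ₃. -/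
open MvPolynomial

theorem Fin.exists_eq_succAbove_of_strictMono {m : ℕ} {g : Fin m → Fin (m + 1)}
    (hg : StrictMono g) : ∃ p : Fin (m + 1), g = p.succAbove := by
  obtain ⟨p, hp⟩ : ∃ p, p ∉ Set.range g := by
    by_contra! h
    simpa using Fintype.card_le_of_surjective g h
  refine ⟨p, (hg.range_inj (Fin.strictMono_succAbove p)).1 ?_⟩
  rw [Fin.range_succAbove]
  have hs : Finset.univ.image g = {p}ᶜ := by
    apply Finset.eq_of_subset_of_card_le
    · intro x hx
      simp only [Finset.mem_image, Finset.mem_univ, true_and] at hx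
      simp only [Finset.mem_compl, Finset.mem_singleton]
      rintro rfl
      exact hp hx
    · rw [Finset.card_image_of_injective _ hg.injective, Finset.card_compl]
      simp
  simpa using congrArg (fun s : Finset (Fin (m + 1)) => (s : Set (Fin (m + 1)))) hs

theorem Fin.forall_succAbove_le_succAbove_iff {m : ℕ} {p q : Fin (m + 1)} :
    (∀ i, p.succAbove i ≤ q.succAbove i) ↔ q ≤ p := by
  constructor
  · intro h
    by_contra! hpq
    have hi := h ⟨p, by omega⟩
    simp only [Fin.succAbove, Fin.lt_def, Fin.le_def, Fin.val_castSucc] at hi hpq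
    simp [hpq] at hi
  · intro h i
    simp only [Fin.succAbove, Fin.lt_def, Fin.le_def, Fin.val_castSucc] at h ⊢
    split_ifs <;> simp only [Fin.val_castSucc, Fin.val_succ] <;> omega

open scoped Classical in
/-- A tableau of rectangular shape with one row fewer than the number of entries is determined by
the entries missing from its columns, which form an antitone sequence. -/
theorem sum_map_ssytWeights_rectangle {M : Type*} [AddCommMonoid M] (lam : List ℕ) (k : ℕ)
    (hk : ∀ i, lam.get i = k) (g : MvPolynomial (Fin (lam.length + 1)) ℤ → M) :
    ((ssytWeights lam (lam.length + 1)).map g).sum =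
      ∑ f : Fin k → Fin (lam.length + 1) with Antitone f,
        g (∑ j, (esymm (Fin (lam.length + 1)) ℤ 1 - X (f j))) := by
  rw [ssytWeights, Multiset.map_map]
  symm
  refine Finset.sum_bij (fun f _ i j => (f (Fin.cast (hk i) j)).succAbove i) ?_ ?_ ?_ ?_
  · intro f hf
    simp only [Finset.mem_filter, Finset.mem_univ, true_and] at hf ⊢
    refine ⟨fun i j j' hj => ?_, fun i i' hi j hj => ?_⟩
    · have hle : Fin.cast (hk i) j ≤ Fin.cast (hk i) j' := hj
      exact Fin.forall_succAbove_le_succAbove_iff.2 (hf hle) i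
    · exact Fin.strictMono_succAbove (f (Fin.cast (hk i') j)) hi
  · intro f _ f' _ h
    funext j
    apply Fin.succAbove_left_injective
    funext i
    exact congrFun (congrFun h i) (Fin.cast (hk i).symm j)
  · intro T hT
    simp only [Finset.mem_filter, Finset.mem_univ, true_and] at hT
    have hcol (j : Fin k) : ∃ p : Fin (lam.length + 1),
        (fun i => T i (Fin.cast (hk i).symm j)) = p.succAbove :=
      Fin.exists_eq_succAbove_of_strictMono fun i i' hi =>
        hT.2 i i' hi (Fin.cast (hk i').symm j) (by simp [-List.get_eq_getElem, hk])
    choose f hf using hcol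
    refine ⟨f, ?_, ?_⟩
    · simp only [Finset.mem_filter, Finset.mem_univ, true_and]
      intro j j' hj
      refine Fin.forall_succAbove_le_succAbove_iff.1 fun i => ?_
      rw [← hf, ← hf]
      exact hT.1 i _ _ hj
    · funext i j
      exact (congrFun (hf (Fin.cast (hk i) j)) i).symm
  · intro f _
    have hrow (i : Fin lam.length) :
        ∑ j : Fin (lam.get i), (X ((f (Fin.cast (hk i) j)).succAbove i) :
          MvPolynomial (Fin (lam.length + 1)) ℤ) = ∑ j, X ((f j).succAbove i) :=
      Fintype.sum_equiv (finCongr (hk i)) _ _ fun _ => rfl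
    simp only [Function.comp_apply, hrow]
    rw [Finset.sum_comm]
    congr 1
    refine Finset.sum_congr rfl fun j _ => ?_
    rw [esymm_one, Fin.sum_univ_succAbove _ (f j), add_sub_cancel_left]

open scoped Classical in
theorem sum_antitone_fin_three {M : Type*} [AddCommMonoid M] (n : ℕ)
    (g : ℕ → ℕ → ℕ → M) :
    ∑ f : Fin 3 → Fin n with Antitone f, g (f 0) (f 1) (f 2) =
      ∑ a ∈ Finset.range n, ∑ b ∈ Finset.range (a + 1), ∑ c ∈ Finset.range (b + 1), g a b c := by
  simp only [Finset.sum_sigma']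
  refine Finset.sum_bij (fun f _ => ⟨f 0, f 1, f 2⟩) ?_ ?_ ?_ ?_
  · intro f hf
    simp only [Finset.mem_filter, Finset.mem_univ, true_and] at hf
    have h₁ := hf (show (0 : Fin 3) ≤ 1 by decide)
    have h₂ := hf (show (1 : Fin 3) ≤ 2 by decide)
    simp only [Fin.le_def] at h₁ h₂
    simp only [Finset.mem_sigma, Finset.mem_range]
    omega
  · intro f _ f' _ h
    simp only [Sigma.mk.injEq, heq_eq_eq, Fin.val_inj] at h
    funext j
    fin_cases j
    exacts [h.1, h.2.1, h.2.2]
  · rintro ⟨a, b, c⟩ h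
    simp only [Finset.mem_sigma, Finset.mem_range] at h
    refine ⟨![⟨a, by omega⟩, ⟨b, by omega⟩, ⟨c, by omega⟩], ?_, by simp⟩
    simp only [Finset.mem_filter, Finset.mem_univ, true_and]
    rw [Fin.antitone_iff_succ_le]
    intro i
    fin_cases i <;> simp [Fin.le_def] <;> omega
  · intro f _
    rfl

theorem sum_triples_range_nine {R : Type*} [CommRing R] (y : ℕ → R) (e : R) :
    ∑ a ∈ Finset.range 9, ∑ b ∈ Finset.range (a + 1), ∑ c ∈ Finset.range (b + 1),
      ((e - y a) + (e - y b) + (e - y c)) = 495 * e - 55 * ∑ a ∈ Finset.range 9, y a := by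
  simp only [Finset.sum_range_succ, Finset.sum_range_zero]
  ring

theorem sum_sq_triples_range_nine {R : Type*} [CommRing R] (y : ℕ → R) (e : R) :
    ∑ a ∈ Finset.range 9, ∑ b ∈ Finset.range (a + 1), ∑ c ∈ Finset.range (b + 1),
      ((e - y a) + (e - y b) + (e - y c)) ^ 2 =
      1485 * e ^ 2 - 330 * e * ∑ a ∈ Finset.range 9, y a +
        11 * (∑ a ∈ Finset.range 9, y a) ^ 2 + 66 * ∑ a ∈ Finset.range 9, y a ^ 2 := by
  simp only [Finset.sum_range_succ, Finset.sum_range_zero]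
  ring

theorem two_mul_esymm_two_eq (σ : Type*) [Fintype σ] :
    2 * esymm σ ℤ 2 = esymm σ ℤ 1 ^ 2 - ∑ i, (X i : MvPolynomial σ ℤ) ^ 2 := by
  rw [esymm_one, esymm_eq_multiset_esymm, Multiset.two_mul_esymm_two, Multiset.map_map]
  rfl

/-- `c₂(γ9^[3, 3, 3, 3, 3, 3, 3, 3]) = 66·c₂(γ9)`: the second elementary symmetric function of
the multiset of weights of semistandard Young tableaux of shape `[3, 3, 3, 3, 3, 3, 3, 3]` with
entries in `{0, …, 8}` is congruent to `66·e₂` modulo the ideal generated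
by `e₁`. -/
theorem c2_ssyt_stmt19 :
    Multiset.esymm (ssytWeights [3, 3, 3, 3, 3, 3, 3, 3] 9) 2 - 66 * esymm (Fin 9) ℤ 2
      ∈ Ideal.span {esymm (Fin 9) ℤ 1} := by
  have hk : ∀ i, [3, 3, 3, 3, 3, 3, 3, 3].get i = 3 := by decide
  let y : ℕ → MvPolynomial (Fin 9) ℤ := fun a => if h : a < 9 then X ⟨a, h⟩ else 0
  have hy (a : Fin 9) : X a = y a := by simp [y]
  have hsum : ∑ a ∈ Finset.range 9, y a = esymm (Fin 9) ℤ 1 := by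
    simp only [esymm_one, hy, Fin.sum_univ_eq_sum_range y]
  have hsq : ∑ a ∈ Finset.range 9, y a ^ 2 = ∑ i, (X i : MvPolynomial (Fin 9) ℤ) ^ 2 := by
    simp only [hy, Fin.sum_univ_eq_sum_range (fun a => y a ^ 2)]
  have h₁ : (ssytWeights [3, 3, 3, 3, 3, 3, 3, 3] 9).sum = 440 * esymm (Fin 9) ℤ 1 := by
    have h := sum_map_ssytWeights_rectangle _ 3 hk id
    simp only [List.length_cons, List.length_nil, Nat.reduceAdd, id, Multiset.map_id', hy,
      Fin.sum_univ_three] at h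
    rw [h, sum_antitone_fin_three 9 fun a b c => (esymm (Fin 9) ℤ 1 - y a) +
      (esymm (Fin 9) ℤ 1 - y b) + (esymm (Fin 9) ℤ 1 - y c), sum_triples_range_nine, hsum]
    ring
  have h₂ : ((ssytWeights [3, 3, 3, 3, 3, 3, 3, 3] 9).map (· ^ 2)).sum =
      1232 * esymm (Fin 9) ℤ 1 ^ 2 - 132 * esymm (Fin 9) ℤ 2 := by
    have h := sum_map_ssytWeights_rectangle _ 3 hk (· ^ 2)
    simp only [List.length_cons, List.length_nil, Nat.reduceAdd, hy, Fin.sum_univ_three] at h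
    rw [h, sum_antitone_fin_three 9 fun a b c => ((esymm (Fin 9) ℤ 1 - y a) +
      (esymm (Fin 9) ℤ 1 - y b) + (esymm (Fin 9) ℤ 1 - y c)) ^ 2, sum_sq_triples_range_nine,
      hsum, hsq]
    linear_combination 66 * two_mul_esymm_two_eq (Fin 9)
  have h₃ : Multiset.esymm (ssytWeights [3, 3, 3, 3, 3, 3, 3, 3] 9) 2 - 66 * esymm (Fin 9) ℤ 2 =
      96184 * esymm (Fin 9) ℤ 1 * esymm (Fin 9) ℤ 1 := by
    apply mul_left_cancel₀ (two_ne_zero (α := MvPolynomial (Fin 9) ℤ))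
    rw [mul_sub, Multiset.two_mul_esymm_two, h₁, h₂]
    ring
  rw [h₃]
  exact Ideal.mul_mem_left _ _ (Ideal.mem_span_singleton_self _)
end
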